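/- (Theorem 3) Let A be a random M×N matrix over F_q drawn from the row-erasure model, with M ≥ N ≥ 1. Then the probability of decoding failure P_fail := Pr(rank(A) < N) satisfies P_fail ≤ Σ_{r=0}^{M} C(M,r)·ε_RD^{M−r}·(1−ε_RD)^r·min{η_max(N,r), μ0(N,r)}, where for r ≥ N, η_max(N,r) = 1 − Π_{i=1}^{N}(1 − β_max^{r−i+1}) with β_max = max(ε_SR, (1−ε_SR)/(q−1)), η_max(N,r) = 1 for r < N, and μ0(N,r) = (1/(q−1))·Σ_{w=1}^{N} C(N,w)·(q−1)^w·γ_w^r. -/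

import Mathlib

open Finset
open scoped Classical

noncomputable section

/-- The entry distribution μ on the finite field `F`: the value `0` has
probability `ε_SR` and each nonzero value has probability `(1-ε_SR)/(q-1)`,
where `q = |F|`. -/
def muDist (F : Type*) [Field F] [Fintype F] [DecidableEq F] (εSR : ℝ) (t : F) : ℝ :=
  if t = 0 then εSR else (1 - εSR) / ((Fintype.card F : ℝ) - 1)

/-- Row distribution of the row-erasure model: a row is the zero row with
probability `ε_RD`, and otherwise consists of `N` i.i.d. `μ`-distributed entries. -/
def reRowProb (F : Type*) [Field F] [Fintype F] [DecidableEq F] (εSR εRD : ℝ) {N : ℕ}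
    (v : Fin N → F) : ℝ :=
  (if v = 0 then εRD else 0) + (1 - εRD) * ∏ j, muDist F εSR (v j)

/-- The probability that a random `M × N` matrix drawn from the row-erasure model
(independent rows, each distributed as `reRowProb`) equals the fixed matrix `A`. -/
def reMatProb (F : Type*) [Field F] [Fintype F] [DecidableEq F] (εSR εRD : ℝ) {M N : ℕ}
    (A : Matrix (Fin M) (Fin N) F) : ℝ :=
  ∏ i, reRowProb F εSR εRD (A i)

/-- `γ_w = q⁻¹ + (1 - q⁻¹)·(1 - (1-ε_SR)/(1-q⁻¹))^w`. -/
def gammaW (q εSR : ℝ) (w : ℕ) : ℝ :=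
  q⁻¹ + (1 - q⁻¹) * (1 - (1 - εSR) / (1 - q⁻¹)) ^ w

/-- `μ0(N,r) = (1/(q-1))·Σ_{w=1}^{N} C(N,w)·(q-1)^w·γ_w^r`. -/
def mu0 (q εSR : ℝ) (N r : ℕ) : ℝ :=
  (1 / (q - 1)) * ∑ w ∈ Icc 1 N, (N.choose w : ℝ) * (q - 1) ^ w * gammaW q εSR w ^ r

/-- `η_max(N,r) = 1 − Π_{i=1}^{N}(1 − β_max^{r−i+1})` for `r ≥ N`, with the
convention `η_max(N,r) = 1` for `r < N`, where `β_max = max(ε_SR, (1−ε_SR)/(q−1))`. -/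
def etaMax (q εSR : ℝ) (N r : ℕ) : ℝ :=
  if N ≤ r then
    1 - ∏ i ∈ Icc 1 N, (1 - (max εSR ((1 - εSR) / (q - 1))) ^ (r - i + 1))
  else 1

lemma sum_fin_succ_fun {X : Type*} [Fintype X] {n : ℕ} (f : (Fin (n + 1) → X) → ℝ) :
    ∑ c, f c = ∑ x, ∑ v : Fin n → X, f (Fin.cons x v) := by
  rw [← Fintype.sum_prod_type' (fun x (v : Fin n → X) => f (Fin.cons x v))]
  exact (Fintype.sum_equiv (Fin.consEquiv fun _ => X) _ _ fun _ => rfl).symm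

lemma sum_prod_apply {ι X : Type*} [Fintype ι] [DecidableEq ι] [Fintype X] (f : ι → X → ℝ) :
    ∑ c : ι → X, ∏ i, f i (c i) = ∏ i, ∑ x, f i x := by
  rw [Finset.prod_univ_sum, Fintype.piFinset_univ]

/-- A subspace of `ι → F` of dimension at most `n` has an information set of size at most `n`. -/
lemma exists_information_set {F ι : Type*} [Field F] [Fintype ι] (n : ℕ) :
    ∀ V : Submodule F (ι → F), Module.finrank F V ≤ n →
      ∃ I : Finset ι, #I ≤ n ∧ ∀ v ∈ V, (∀ i ∈ I, v i = 0) → v = 0 := by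
  induction n with
  | zero =>
    intro V hV
    have hbot : V = ⊥ := Submodule.finrank_eq_zero.mp (Nat.le_zero.mp hV)
    exact ⟨∅, by simp, fun v hv _ => by simpa [hbot] using hv⟩
  | succ n ih =>
    intro V hV
    by_cases hbot : V = ⊥
    · exact ⟨∅, by simp, fun v hv _ => by simpa [hbot] using hv⟩
    obtain ⟨u, hu, hu0⟩ := Submodule.exists_mem_ne_zero_of_ne_bot hbot
    obtain ⟨i, hi⟩ := Function.ne_iff.mp hu0
    let K : Submodule F (ι → F) := LinearMap.ker (LinearMap.proj i : (ι → F) →ₗ[F] F)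
    have hlt : V ⊓ K < V := by
      refine lt_of_le_of_ne inf_le_left fun h => hi ?_
      have : u ∈ V ⊓ K := h.ge hu
      simpa [K] using this.2
    obtain ⟨I, hI, hV'⟩ := ih (V ⊓ K) (by
      have := Submodule.finrank_lt_finrank_of_lt hlt
      omega)
    refine ⟨insert i I, (card_insert_le _ _).trans (by omega), fun v hv h => hV' v ⟨hv, ?_⟩ ?_⟩
    · simpa [K] using h i (mem_insert_self _ _)
    · exact fun j hj => h j (mem_insert_of_mem hj)

/-- A random vector with independent coordinates, the `i`-th one having atoms of mass at most
`b i`, lies in a `k`-dimensional subspace with probability at most the product of the `b i` over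
the complement of some set of at most `k` coordinates. -/
lemma exists_prob_mem_submodule_le {F ι : Type*} [Field F] [Fintype F] [Fintype ι]
    [DecidableEq ι] (w : ι → F → ℝ) (b : ι → ℝ) (hw : ∀ i t, 0 ≤ w i t) (hw1 : ∀ i, ∑ t, w i t = 1)
    (hb : ∀ i t, w i t ≤ b i) (V : Submodule F (ι → F)) :
    ∃ I : Finset ι, #I ≤ Module.finrank F V ∧
      (∑ v : ι → F, if v ∈ V then ∏ i, w i (v i) else 0) ≤ ∏ i ∈ Iᶜ, b i := by
  obtain ⟨I, hI, hV⟩ := exists_information_set _ V le_rfl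
  refine ⟨I, hI, ?_⟩
  have hb0 : ∀ i, 0 ≤ b i := fun i => (hw i 0).trans (hb i 0)
  have hmain : ∑ v : ι → F with v ∈ V, ∏ i ∈ I, w i (v i) ≤ 1 := by
    have hinj : Set.InjOn (fun (v : ι → F) (i : I) => v i) {v : ι → F | v ∈ V} := by
      intro u hu v hv h
      refine sub_eq_zero.mp (hV _ (V.sub_mem hu hv) fun i hi => ?_)
      simpa [sub_eq_zero] using congrFun h ⟨i, hi⟩
    calc ∑ v : ι → F with v ∈ V, ∏ i ∈ I, w i (v i)
        = ∑ v : ι → F with v ∈ V, ∏ i : I, w i (v i) :=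
          sum_congr rfl fun v _ => (prod_coe_sort I fun i => w i (v i)).symm
      _ = ∑ u ∈ (univ.filter fun v : ι → F => v ∈ V).image
            (fun (v : ι → F) (i : I) => v i), ∏ i : I, w i (u i) := by
          rw [sum_image]
          simpa using hinj
      _ ≤ ∑ u : I → F, ∏ i : I, w i (u i) :=
          sum_le_sum_of_subset_of_nonneg (subset_univ _) fun u _ _ =>
            prod_nonneg fun i _ => hw _ _
      _ = 1 := by
          rw [sum_prod_apply (fun (i : I) t => w i t)]
          simp [hw1]
  rw [← sum_filter]
  calc ∑ v : ι → F with v ∈ V, ∏ i, w i (v i)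
      ≤ ∑ v : ι → F with v ∈ V, (∏ i ∈ I, w i (v i)) * ∏ i ∈ Iᶜ, b i := by
        refine sum_le_sum fun v _ => ?_
        rw [← prod_mul_prod_compl I]
        exact mul_le_mul_of_nonneg_left (prod_le_prod (fun i _ => hw _ _) fun i _ => hb _ _)
          (prod_nonneg fun i _ => hw _ _)
    _ = (∑ v : ι → F with v ∈ V, ∏ i ∈ I, w i (v i)) * ∏ i ∈ Iᶜ, b i := by rw [sum_mul]
    _ ≤ ∏ i ∈ Iᶜ, b i := mul_le_of_le_one_left (prod_nonneg fun i _ => hb0 i) hmain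

/-- If an independent sample falls in any given `k`-dimensional subspace with probability at most
`δ k`, then `N` independent samples are linearly independent with probability at least
`∏ k < N, (1 - δ k)`. -/
lemma prob_linearIndependent_ge {E : Type*} [AddCommGroup E] {F : Type*} [Field F] [Module F E]
    [Fintype E] (P : E → ℝ) (hP : ∀ x, 0 ≤ P x) (hP1 : ∑ x, P x = 1)
    (δ : ℕ → ℝ) (N : ℕ) (hδ1 : ∀ k < N, δ k ≤ 1)
    (hδ : ∀ k < N, ∀ V : Submodule F E, Module.finrank F V = k →
      (∑ x, if x ∈ V then P x else 0) ≤ δ k) :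
    ∏ k ∈ range N, (1 - δ k) ≤
      ∑ c : Fin N → E, if LinearIndependent F c then ∏ j, P (c j) else 0 := by
  induction N with
  | zero => simp
  | succ n ih =>
    have ih := ih (fun k hk => hδ1 k (by omega)) (fun k hk => hδ k (by omega))
    rw [sum_fin_succ_fun, sum_comm, prod_range_succ]
    refine (mul_le_mul_of_nonneg_right ih (sub_nonneg.mpr (hδ1 n (by omega)))).trans ?_
    rw [sum_mul]
    refine sum_le_sum fun v _ => ?_
    by_cases hv : LinearIndependent F v
    · have hcompl : ∑ x, (if x ∈ Submodule.span F (Set.range v) then 0 else P x) =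
          1 - ∑ x, if x ∈ Submodule.span F (Set.range v) then P x else 0 := by
        rw [eq_sub_iff_add_eq, ← sum_add_distrib, ← hP1]
        exact sum_congr rfl fun x _ => by split_ifs <;> simp
      have hspan := hδ n (by omega) (Submodule.span F (Set.range v)) (by
        rw [finrank_span_eq_card hv, Fintype.card_fin])
      calc _ = (∏ j, P (v j)) * (1 - δ n) := by rw [if_pos hv]
        _ ≤ (∏ j, P (v j)) * ∑ x, (if x ∈ Submodule.span F (Set.range v) then 0 else P x) := by
          rw [hcompl]
          exact mul_le_mul_of_nonneg_left (by linarith) (prod_nonneg fun _ _ => hP _)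
        _ = _ := by
          rw [mul_sum]
          refine sum_congr rfl fun x _ => ?_
          simp only [linearIndependent_finCons, hv, true_and, Fin.prod_univ_succ, Fin.cons_zero,
            Fin.cons_succ]
          split_ifs with h <;> simp [mul_comm]
    · simp only [linearIndependent_finCons, hv, false_and, if_false, zero_mul]
      simp

/-- The sum over the nonzero vectors of a function of the Hamming weight. -/
lemma sum_ne_zero_hammingNorm {F : Type*} [Field F] [Fintype F] [DecidableEq F] (N : ℕ)
    (h : ℕ → ℝ) :
    ∑ x : Fin N → F with x ≠ 0, h (hammingNorm x) =
      ∑ w ∈ Icc 1 N, (N.choose w : ℝ) * ((Fintype.card F : ℝ) - 1) ^ w * h w := by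
  have hcard (T : Finset (Fin N)) :
      (#{x : Fin N → F | ({i | x i ≠ 0} : Finset (Fin N)) = T} : ℝ) =
        ((Fintype.card F : ℝ) - 1) ^ #T := by
    have : ({x : Fin N → F | ({i | x i ≠ 0} : Finset (Fin N)) = T} : Finset (Fin N → F)) =
        Fintype.piFinset fun i => if i ∈ T then univ.erase (0 : F) else {0} := by
      ext x
      simp only [mem_filter, mem_univ, true_and, Fintype.mem_piFinset, Finset.ext_iff]
      refine forall_congr' fun i => ?_
      by_cases hi : i ∈ T <;> simp [hi]
    rw [this, Fintype.card_piFinset]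
    simp only [apply_ite card, card_singleton, card_erase_of_mem (mem_univ _), card_univ]
    rw [prod_ite_mem, univ_inter, prod_const, Nat.cast_pow, Nat.cast_sub Fintype.card_pos,
      Nat.cast_one]
  have hall (h : ℕ → ℝ) : ∑ x : Fin N → F, h (hammingNorm x) =
      ∑ w ∈ range (N + 1), (N.choose w : ℝ) * ((Fintype.card F : ℝ) - 1) ^ w * h w := by
    rw [← sum_fiberwise_of_maps_to (s := univ) (t := (univ : Finset (Fin N)).powerset)
      (g := fun x : Fin N → F => ({i | x i ≠ 0} : Finset (Fin N))) (by simp)]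
    have : ∀ T ∈ (univ : Finset (Fin N)).powerset,
        ∑ x : Fin N → F with ({i | x i ≠ 0} : Finset (Fin N)) = T, h (hammingNorm x) =
          ((Fintype.card F : ℝ) - 1) ^ #T * h #T := by
      intro T _
      rw [← hcard, ← nsmul_eq_mul, ← sum_const]
      refine sum_congr rfl fun x hx => ?_
      rw [← (mem_filter.mp hx).2, hammingNorm]
    rw [sum_congr rfl this,
      sum_powerset_apply_card (fun w => ((Fintype.card F : ℝ) - 1) ^ w * h w), card_univ,
      Fintype.card_fin]
    simp [mul_assoc]
  have h0 := hall fun w => if w = 0 then 0 else h w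
  rw [sum_filter]
  calc _ = ∑ x : Fin N → F, (if hammingNorm x = 0 then 0 else h (hammingNorm x)) := by
        refine sum_congr rfl fun x _ => ?_
        by_cases hx : x = 0 <;> simp [hx]
    _ = _ := h0
    _ = _ := by
        rw [range_eq_Ico, sum_eq_sum_Ico_succ_bot (Nat.succ_pos N)]
        simp only [if_true, mul_zero, zero_add]
        refine sum_congr (by ext; simp [Nat.succ_le_iff]) fun w hw => ?_
        rw [if_neg (by simp at hw; omega)]

lemma one_lt_card_real {F : Type*} [Field F] [Fintype F] : (1 : ℝ) < Fintype.card F := by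
  exact_mod_cast Fintype.one_lt_card

section

variable {F : Type*} [Field F] [Fintype F] [DecidableEq F]

lemma sum_muDist (ε : ℝ) : ∑ t : F, muDist F ε t = 1 := by
  have h := one_lt_card_real (F := F)
  rw [← add_sum_erase _ _ (mem_univ (0 : F)),
    sum_congr rfl fun t ht => show muDist F ε t = (1 - ε) / ((Fintype.card F : ℝ) - 1) by
      simp [muDist, ne_of_mem_erase ht]]
  rw [sum_const, card_erase_of_mem (mem_univ _), card_univ, nsmul_eq_mul,
    Nat.cast_sub Fintype.card_pos, Nat.cast_one, mul_div_cancel₀ _ (by linarith)]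
  simp [muDist]

lemma muDist_nonneg {ε : ℝ} (hε : ε ∈ Set.Icc (0 : ℝ) 1) (t : F) : 0 ≤ muDist F ε t := by
  have h := one_lt_card_real (F := F)
  unfold muDist
  split_ifs
  · exact hε.1
  · exact div_nonneg (by linarith [hε.2]) (by linarith)

lemma muDist_le (ε : ℝ) (t : F) :
    muDist F ε t ≤ max ε ((1 - ε) / ((Fintype.card F : ℝ) - 1)) := by
  unfold muDist
  split_ifs
  · exact le_max_left _ _
  · exact le_max_right _ _

/-- The distribution of the dot product of a vector of i.i.d. `muDist` entries with `x`. -/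
lemma sum_muDist_dotProduct (ε : ℝ) {n : ℕ} (x : Fin n → F) : ∀ s : F,
    (∑ v : Fin n → F, if ∑ j, v j * x j = s then ∏ j, muDist F ε (v j) else 0) =
      (Fintype.card F : ℝ)⁻¹ + ((if s = 0 then 1 else 0) - (Fintype.card F : ℝ)⁻¹) *
        (1 - (1 - ε) / (1 - (Fintype.card F : ℝ)⁻¹)) ^ hammingNorm x := by
  induction n with
  | zero => intro s; simp [hammingNorm, eq_comm]
  | succ n ih =>
    intro s
    have hq := one_lt_card_real (F := F)
    rw [sum_fin_succ_fun]
    have hstep (t : F) : (∑ v : Fin n → F,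
        if ∑ j, (Fin.cons t v : Fin (n + 1) → F) j * x j = s then
          ∏ j, muDist F ε ((Fin.cons t v : Fin (n + 1) → F) j) else 0) =
        muDist F ε t * ∑ v : Fin n → F,
          if ∑ j, v j * x (Fin.succ j) = s - t * x 0 then ∏ j, muDist F ε (v j) else 0 := by
      rw [mul_sum]
      refine sum_congr rfl fun v _ => ?_
      simp only [Fin.sum_univ_succ, Fin.prod_univ_succ, Fin.cons_zero, Fin.cons_succ,
        eq_sub_iff_add_eq', mul_ite, mul_zero]
    simp only [hstep, ih (fun j => x (Fin.succ j))]
    set ρ := 1 - (1 - ε) / (1 - (Fintype.card F : ℝ)⁻¹) with hρ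
    set k := hammingNorm fun j => x (Fin.succ j) with hk
    have hnorm : hammingNorm x = (if x 0 = 0 then 0 else 1) + k := by
      rw [hk]
      simp only [hammingNorm, card_filter, Fin.sum_univ_succ]
      by_cases h0 : x 0 = 0 <;> simp [h0]
    rw [hnorm]
    by_cases h0 : x 0 = 0
    · simp only [h0, mul_zero, sub_zero, if_true, zero_add]
      rw [← sum_mul, sum_muDist, one_mul]
    · have hiff (t : F) : s - t * x 0 = 0 ↔ t = s / x 0 := by
        rw [sub_eq_zero, eq_div_iff h0, eq_comm]
      have hmu (t : F) : muDist F ε t - (Fintype.card F : ℝ)⁻¹ =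
          ((if t = 0 then 1 else 0) - (Fintype.card F : ℝ)⁻¹) * ρ := by
        have h1 : (Fintype.card F : ℝ) - 1 ≠ 0 := by linarith
        have h2 : (Fintype.card F : ℝ) ≠ 0 := by linarith
        unfold muDist
        rw [hρ]
        have h3 : 1 - (Fintype.card F : ℝ)⁻¹ = (Fintype.card F - 1) / Fintype.card F := by
          field_simp
        rw [h3]
        split_ifs <;> field_simp <;> ring
      have hs : (if s = 0 then (1 : ℝ) else 0) = if s / x 0 = 0 then 1 else 0 := by
        simp [div_eq_zero_iff, h0]
      simp only [hiff, h0, if_false]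
      calc _ = ∑ t : F, (muDist F ε t * ((Fintype.card F : ℝ)⁻¹ * (1 - ρ ^ k)) +
              if t = s / x 0 then muDist F ε t * ρ ^ k else 0) := by
            refine sum_congr rfl fun t _ => ?_
            split_ifs <;> ring
        _ = (Fintype.card F : ℝ)⁻¹ +
              (muDist F ε (s / x 0) - (Fintype.card F : ℝ)⁻¹) * ρ ^ k := by
            rw [sum_add_distrib, ← sum_mul, sum_muDist, sum_ite_eq' univ (s / x 0),
              if_pos (mem_univ _)]
            ring
        _ = _ := by rw [hmu, hs]; ring

/-- The entry distribution of the matrix conditioned on `S` being the set of non-erased rows. -/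
def entryProb (F : Type*) [Field F] [Fintype F] [DecidableEq F] (ε : ℝ) {ι : Type*}
    (S : Finset ι) (i : ι) (t : F) : ℝ :=
  if i ∈ S then muDist F ε t else if t = 0 then 1 else 0

lemma entryProb_nonneg {ε : ℝ} (hε : ε ∈ Set.Icc (0 : ℝ) 1) {ι : Type*} (S : Finset ι) (i : ι)
    (t : F) : 0 ≤ entryProb F ε S i t := by
  unfold entryProb
  split_ifs
  exacts [muDist_nonneg hε t, zero_le_one, le_rfl]

lemma sum_entryProb (ε : ℝ) {ι : Type*} (S : Finset ι) (i : ι) :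
    ∑ t : F, entryProb F ε S i t = 1 := by
  by_cases hi : i ∈ S <;> simp [entryProb, hi, sum_muDist]

lemma reMatProb_eq_sum (εSR εRD : ℝ) {M N : ℕ} (A : Matrix (Fin M) (Fin N) F) :
    reMatProb F εSR εRD A = ∑ S ∈ (univ : Finset (Fin M)).powerset,
      εRD ^ (M - #S) * (1 - εRD) ^ #S * ∏ i, ∏ j, entryProb F εSR S i (A i j) := by
  unfold reMatProb reRowProb
  simp_rw [add_comm (ite _ _ _)]
  rw [prod_add]
  refine sum_congr rfl fun S _ => ?_
  rw [← prod_mul_prod_compl S (fun i => ∏ j, entryProb F εSR S i (A i j)), prod_mul_distrib,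
    prod_const, ← compl_eq_univ_sdiff]
  have h1 : ∏ i ∈ S, ∏ j, entryProb F εSR S i (A i j) = ∏ i ∈ S, ∏ j, muDist F εSR (A i j) :=
    prod_congr rfl fun i hi => by simp [entryProb, hi]
  have h2 : (∏ i ∈ Sᶜ, if A i = 0 then εRD else 0) =
      εRD ^ (M - #S) * ∏ i ∈ Sᶜ, ∏ j, entryProb F εSR S i (A i j) := by
    have hcard : M - #S = #Sᶜ := by rw [card_compl, Fintype.card_fin]
    rw [hcard, ← prod_const, ← prod_mul_distrib]
    refine prod_congr rfl fun i hi => ?_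
    simp only [entryProb, mem_compl.mp hi, if_false, Fintype.prod_boole]
    by_cases h : A i = 0
    · simp [h]
    · have : ¬ ∀ j, A i j = 0 := fun h' => h (funext h')
      simp [h, this]
  rw [h1, h2]
  ring

lemma rank_lt_iff_not_linearIndependent {K : Type*} [Field K] {M N : ℕ}
    (A : Matrix (Fin M) (Fin N) K) : A.rank < N ↔ ¬ LinearIndependent K A.col := by
  rw [linearIndependent_iff_card_eq_finrank_span, Set.finrank, ← A.rank_eq_finrank_span_cols,
    Fintype.card_fin]
  have := A.rank_le_width
  omega

lemma sum_prob_matrix (ε : ℝ) {M N : ℕ} (S : Finset (Fin M)) :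
    ∑ A : Matrix (Fin M) (Fin N) F, ∏ i, ∏ j, entryProb F ε S i (A i j) = 1 := by
  have h := sum_prod_apply (ι := Fin M) (X := Fin N → F)
    fun i v => ∏ j, entryProb F ε S i (v j)
  refine h.trans ?_
  refine prod_eq_one fun i _ => ?_
  rw [sum_prod_apply fun _ t => entryProb F ε S i t]
  simp [sum_entryProb]

/-- The rank-failure probability given the set `S` of non-erased rows. -/
def rankFailProb (F : Type*) [Field F] [Fintype F] [DecidableEq F] (ε : ℝ) {M : ℕ} (N : ℕ)
    (S : Finset (Fin M)) : ℝ :=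
  ∑ A : Matrix (Fin M) (Fin N) F,
    if A.rank < N then ∏ i, ∏ j, entryProb F ε S i (A i j) else 0

lemma rankFailProb_le_etaMax {ε : ℝ} (hε : ε ∈ Set.Icc (0 : ℝ) 1) {M N : ℕ}
    (S : Finset (Fin M)) : rankFailProb F ε N S ≤ etaMax (Fintype.card F : ℝ) ε N #S := by
  have hq : (2 : ℝ) ≤ Fintype.card F := by exact_mod_cast Fintype.one_lt_card (α := F)
  have hprod0 (A : Matrix (Fin M) (Fin N) F) : 0 ≤ ∏ i, ∏ j, entryProb F ε S i (A i j) :=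
    prod_nonneg fun i _ => prod_nonneg fun j _ => entryProb_nonneg hε S i _
  unfold etaMax
  split_ifs with hNS
  swap
  · rw [← sum_prob_matrix (F := F) (N := N) ε S]
    refine sum_le_sum fun A _ => ?_
    split_ifs
    exacts [le_rfl, hprod0 A]
  set β := max ε ((1 - ε) / ((Fintype.card F : ℝ) - 1)) with hβ
  have hβ0 : 0 ≤ β := hε.1.trans (le_max_left _ _)
  have hβ1 : β ≤ 1 := max_le hε.2 (div_le_one_of_le₀ (by linarith [hε.1]) (by linarith))
  have hcols := prob_linearIndependent_ge (F := F)
    (fun v : Fin M → F => ∏ i, entryProb F ε S i (v i))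
    (fun v => prod_nonneg fun i _ => entryProb_nonneg hε S i _)
    (by rw [sum_prod_apply]; simp [sum_entryProb])
    (fun k => β ^ (#S - k)) N (fun k _ => pow_le_one₀ hβ0 hβ1) (by
      intro k _ V hV
      obtain ⟨I, hI, hle⟩ := exists_prob_mem_submodule_le (entryProb F ε S)
        (fun i => if i ∈ S then β else 1) (entryProb_nonneg hε S) (sum_entryProb ε S)
        (by
          intro i t
          unfold entryProb
          split_ifs
          exacts [muDist_le ε t, le_rfl, zero_le_one]) V
      refine hle.trans ?_
      rw [prod_ite_mem, prod_const]
      refine pow_le_pow_of_le_one hβ0 hβ1 ?_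
      have h1 := le_card_sdiff I S
      have h2 : S \ I = Iᶜ ∩ S := by ext; simp [and_comm]
      rw [h2] at h1
      omega)
  have hcompl : rankFailProb F ε N S = 1 - ∑ c : Fin N → Fin M → F,
      if LinearIndependent F c then ∏ j, ∏ i, entryProb F ε S i (c j i) else 0 := by
    rw [eq_sub_iff_add_eq, ← sum_prob_matrix (F := F) (N := N) ε S, rankFailProb,
      ← Fintype.sum_equiv (Equiv.piComm fun (_ : Fin M) (_ : Fin N) => F)
        (fun A => if LinearIndependent F (Matrix.col A) then
          ∏ i, ∏ j, entryProb F ε S i (A i j) else 0) _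
        (fun A => by rw [prod_comm]; rfl)]
    refine sum_add_distrib.symm.trans (sum_congr rfl fun A _ => ?_)
    by_cases h : LinearIndependent F (Matrix.col A)
    · rw [if_neg (by rw [rank_lt_iff_not_linearIndependent]; exact not_not.mpr h), if_pos h,
        zero_add]
    · rw [if_pos ((rank_lt_iff_not_linearIndependent _).mpr h), if_neg h, add_zero]
  have hreindex : ∏ i ∈ Icc 1 N, (1 - β ^ (#S - i + 1)) = ∏ k ∈ range N, (1 - β ^ (#S - k)) := by
    rw [← Ico_add_one_right_eq_Icc, prod_Ico_eq_prod_range, Nat.add_sub_cancel]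
    refine prod_congr rfl fun k hk => ?_
    rw [mem_range] at hk
    congr 2
    omega
  rw [hcompl, hreindex]
  linarith

lemma gammaW_hammingNorm_eq {ε : ℝ} {n : ℕ} (x : Fin n → F) :
    gammaW (Fintype.card F : ℝ) ε (hammingNorm x) =
      ∑ v : Fin n → F, if ∑ j, v j * x j = 0 then ∏ j, muDist F ε (v j) else 0 := by
  rw [sum_muDist_dotProduct, if_pos rfl, gammaW]

lemma prob_mulVec_eq_zero (ε : ℝ) {M N : ℕ} (S : Finset (Fin M)) (x : Fin N → F) :
    (∑ A : Matrix (Fin M) (Fin N) F,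
      if A.mulVec x = 0 then ∏ i, ∏ j, entryProb F ε S i (A i j) else 0) =
      gammaW (Fintype.card F : ℝ) ε (hammingNorm x) ^ #S := by
  have hfac (A : Matrix (Fin M) (Fin N) F) :
      (if A.mulVec x = 0 then ∏ i, ∏ j, entryProb F ε S i (A i j) else 0) =
        ∏ i, if ∑ j, A i j * x j = 0 then ∏ j, entryProb F ε S i (A i j) else 0 := by
    by_cases h : A.mulVec x = 0
    · rw [if_pos h]
      exact prod_congr rfl fun i _ => (if_pos (congrFun h i)).symm
    · obtain ⟨i, hi⟩ := Function.ne_iff.mp h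
      rw [if_neg h]
      exact (prod_eq_zero (mem_univ i) (if_neg hi)).symm
  simp_rw [hfac]
  refine (sum_prod_apply (ι := Fin M) (X := Fin N → F)
    fun i v => if ∑ j, v j * x j = 0 then ∏ j, entryProb F ε S i (v j) else 0).trans ?_
  have hrow (i : Fin M) : (∑ v : Fin N → F,
      if ∑ j, v j * x j = 0 then ∏ j, entryProb F ε S i (v j) else 0) =
      if i ∈ S then gammaW (Fintype.card F : ℝ) ε (hammingNorm x) else 1 := by
    by_cases hi : i ∈ S
    · simp only [entryProb, hi, if_true, gammaW_hammingNorm_eq]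
    · simp only [entryProb, hi, if_false, Fintype.prod_boole]
      rw [sum_eq_single 0]
      · simp
      · intro v _ hv
        have : ¬ ∀ j, v j = 0 := fun h => hv (funext h)
        simp [this]
      · simp
  simp_rw [hrow]
  rw [prod_ite_mem, univ_inter, prod_const]

/-- A rank-deficient matrix kills at least `q - 1` nonzero vectors. -/
lemma card_sub_one_le_card_ker {M N : ℕ} (A : Matrix (Fin M) (Fin N) F) (hA : A.rank < N) :
    (Fintype.card F : ℝ) - 1 ≤ #{x : Fin N → F | x ≠ 0 ∧ A.mulVec x = 0} := by
  rw [rank_lt_iff_not_linearIndependent, ← Matrix.mulVec_injective_iff] at hA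
  obtain ⟨u, v, huv, hne⟩ := Function.not_injective_iff.mp hA
  have hx : u - v ≠ 0 := sub_ne_zero.mpr hne
  have hAx : A.mulVec (u - v) = 0 := by rw [Matrix.mulVec_sub, huv, sub_self]
  have hle : #(univ.erase (0 : F)) ≤ #{x : Fin N → F | x ≠ 0 ∧ A.mulVec x = 0} := by
    refine card_le_card_of_injOn (fun c => c • (u - v)) (fun c hc => ?_) fun c _ d _ h =>
      smul_left_injective F hx h
    have hc0 : c ≠ 0 := by simpa using hc
    simp only [coe_filter, mem_univ, true_and, Set.mem_ofPred_eq]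
    exact ⟨smul_ne_zero hc0 hx, by rw [Matrix.mulVec_smul, hAx, smul_zero]⟩
  rw [card_erase_of_mem (mem_univ _), card_univ] at hle
  have := Fintype.card_pos (α := F)
  rw [sub_le_iff_le_add, ← Nat.cast_add_one]
  exact Nat.cast_le.mpr (by omega)

lemma rankFailProb_le_mu0 {ε : ℝ} (hε : ε ∈ Set.Icc (0 : ℝ) 1) {M N : ℕ}
    (S : Finset (Fin M)) : rankFailProb F ε N S ≤ mu0 (Fintype.card F : ℝ) ε N #S := by
  have hq : 0 < (Fintype.card F : ℝ) - 1 := by linarith [one_lt_card_real (F := F)]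
  have hprod0 (A : Matrix (Fin M) (Fin N) F) : 0 ≤ ∏ i, ∏ j, entryProb F ε S i (A i j) :=
    prod_nonneg fun i _ => prod_nonneg fun j _ => entryProb_nonneg hε S i _
  rw [mu0, one_div, ← div_eq_inv_mul, le_div_iff₀' hq, rankFailProb, mul_sum,
    ← sum_ne_zero_hammingNorm N fun w => gammaW (Fintype.card F : ℝ) ε w ^ #S]
  simp_rw [← prob_mulVec_eq_zero]
  rw [sum_comm]
  refine sum_le_sum fun A _ => ?_
  rw [← sum_filter, filter_filter, sum_const, nsmul_eq_mul]
  split_ifs with hA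
  · refine mul_le_mul_of_nonneg_right ?_ (hprod0 A)
    convert card_sub_one_le_card_ker A hA
  · rw [mul_zero]
    exact mul_nonneg (Nat.cast_nonneg _) (hprod0 A)

end

/-- Theorem 3: for a random `M × N` matrix `A` over `F_q` drawn from
the row-erasure model, with `M ≥ N ≥ 1`, the probability of decoding failure
`P_fail := Pr(rank(A) < N)` satisfies
`P_fail ≤ Σ_{r=0}^{M} C(M,r)·ε_RD^{M−r}·(1−ε_RD)^r·min{η_max(N,r), μ0(N,r)}`. -/
theorem stmt_14 (F : Type*) [Field F] [Fintype F] [DecidableEq F]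
    (hq : 2 ≤ Fintype.card F)
    (εSR : ℝ) (hεSR : εSR ∈ Set.Icc (0 : ℝ) 1)
    (εRD : ℝ) (hεRD : εRD ∈ Set.Icc (0 : ℝ) 1)
    (M N : ℕ) (hN : 1 ≤ N) (hMN : N ≤ M) :
    (∑ A : Matrix (Fin M) (Fin N) F,
        if A.rank < N then reMatProb F εSR εRD A else 0) ≤
      ∑ r ∈ range (M + 1), (M.choose r : ℝ) * εRD ^ (M - r) * (1 - εRD) ^ r *
        min (etaMax (Fintype.card F : ℝ) εSR N r)
          (mu0 (Fintype.card F : ℝ) εSR N r) := by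
  have hexpand : (∑ A : Matrix (Fin M) (Fin N) F,
      if A.rank < N then reMatProb F εSR εRD A else 0) =
      ∑ S ∈ (univ : Finset (Fin M)).powerset,
        εRD ^ (M - #S) * (1 - εRD) ^ #S * rankFailProb F εSR N S := by
    simp_rw [rankFailProb, mul_sum]
    rw [sum_comm]
    refine sum_congr rfl fun A _ => ?_
    split_ifs
    · exact reMatProb_eq_sum εSR εRD A
    · simp
  rw [hexpand]
  calc _ ≤ ∑ S ∈ (univ : Finset (Fin M)).powerset, εRD ^ (M - #S) * (1 - εRD) ^ #S *
        min (etaMax (Fintype.card F : ℝ) εSR N #S) (mu0 (Fintype.card F : ℝ) εSR N #S) :=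
        sum_le_sum fun S _ => mul_le_mul_of_nonneg_left
          (le_min (rankFailProb_le_etaMax hεSR S) (rankFailProb_le_mu0 hεSR S))
          (mul_nonneg (pow_nonneg hεRD.1 _) (pow_nonneg (sub_nonneg.mpr hεRD.2) _))
    _ = _ := by
        rw [sum_powerset_apply_card (fun r => εRD ^ (M - r) * (1 - εRD) ^ r *
          min (etaMax (Fintype.card F : ℝ) εSR N r) (mu0 (Fintype.card F : ℝ) εSR N r)),
          card_univ, Fintype.card_fin]
        simp only [nsmul_eq_mul, mul_assoc]
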